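/- arXiv:2303.16328 — 5 statements merged into one kernel-verified Lean document; each statement's English description precedes it below -/
import Mathlib

section
/- Let F and G be separable real Hilbert spaces and S : F → G a compact linear operator, and let (f_j)_{j≥1} be an orthonormal basis of F consisting of eigenvectors of S*S with eigenvalues λ_1 ≥ λ_2 ≥ ⋯ ≥ 0. Then for every k ≥ 1 and any continuous linear functionals L_1, …, L_{k−1} on F, sup{ ‖S h‖_G : h ∈ F, ‖h‖_F ≤ 1, L_i(h) = 0 for 1 ≤ i ≤ k−1 } ≥ √λ_k. Consequently, if precisions σ_1 ≤ σ_2 ≤ ⋯ ≤ σ_m and functionals L_1,…,L_m with ‖L_i‖ ≤ 1 satisfy sup{‖S h‖ : ‖h‖ ≤ 1, |L_i(h)| ≤ σ_i for all i} ≤ ε√λ_1, then σ_k ≤ ε√(λ_1/λ_k) for every k with λ_k > ε²λ_1. -/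
open Filter
open scoped BigOperators

noncomputable section

/-- Vectors in the span of finitely many orthonormal eigenvectors of `S* S` are stretched by `S`
at least by the square root of the smallest eigenvalue. -/
theorem mul_norm_sq_le_norm_sq_of_eigenvectors {F G ι : Type*} [Fintype ι]
    [NormedAddCommGroup F] [InnerProductSpace ℝ F] [CompleteSpace F]
    [NormedAddCommGroup G] [InnerProductSpace ℝ G] [CompleteSpace G]
    (S : F →L[ℝ] G) {v : ι → F} (hv : Orthonormal ℝ v) {μ : ι → ℝ}
    (heig : ∀ j, (ContinuousLinearMap.adjoint S) (S (v j)) = μ j • v j)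
    {a : ℝ} (ha : ∀ j, a ≤ μ j) (c : ι → ℝ) :
    a * ‖∑ j, c j • v j‖ ^ 2 ≤ ‖S (∑ j, c j • v j)‖ ^ 2 := by
  have hS : ‖S (∑ j, c j • v j)‖ ^ 2 = ∑ j, c j * (μ j * c j) := by
    rw [← real_inner_self_eq_norm_sq, ← ContinuousLinearMap.adjoint_inner_right]
    simp only [map_sum, map_smul, heig, smul_smul]
    rw [hv.inner_sum]
    simp [mul_comm]
  have hn : ‖∑ j, c j • v j‖ ^ 2 = ∑ j, c j * c j := by
    rw [← real_inner_self_eq_norm_sq, hv.inner_sum]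
    simp
  rw [hS, hn, Finset.mul_sum]
  refine Finset.sum_le_sum fun j _ => ?_
  nlinarith [ha j, mul_self_nonneg (c j)]

/-- Fewer than `k + 1` linear functionals have a common zero on the unit sphere at which `‖S h‖`
is at least the square root of the `k`-th eigenvalue of `S* S`. -/
theorem exists_norm_eq_one_sqrt_le_norm_apply {F G : Type*}
    [NormedAddCommGroup F] [InnerProductSpace ℝ F] [CompleteSpace F]
    [NormedAddCommGroup G] [InnerProductSpace ℝ G] [CompleteSpace G]
    (S : F →L[ℝ] G) {b : ℕ → F} (hb : Orthonormal ℝ b) {lam : ℕ → ℝ}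
    (heig : ∀ j, (ContinuousLinearMap.adjoint S) (S (b j)) = lam j • b j)
    (hmono : Antitone lam) (k : ℕ) (L : Fin k → (F →L[ℝ] ℝ)) :
    ∃ h : F, ‖h‖ = 1 ∧ (∀ i, L i h = 0) ∧ Real.sqrt (lam k) ≤ ‖S h‖ := by
  have hv : Orthonormal ℝ fun j : Fin (k + 1) => b j := hb.comp _ Fin.val_injective
  let T : (Fin (k + 1) → ℝ) →ₗ[ℝ] F := Fintype.linearCombination ℝ fun j : Fin (k + 1) => b j
  let Φ : (Fin (k + 1) → ℝ) →ₗ[ℝ] (Fin k → ℝ) :=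
    LinearMap.pi fun i => (L i).toLinearMap ∘ₗ T
  obtain ⟨c, hc, hc0⟩ := (Submodule.ne_bot_iff _).1
    (LinearMap.ker_ne_bot_of_finrank_lt (f := Φ) (by simp))
  have hT : T c = ∑ j, c j • b j := Fintype.linearCombination_apply ..
  have hTc : T c ≠ 0 := fun h0 =>
    hc0 (funext (Fintype.linearIndependent_iff.1 hv.linearIndependent c (hT ▸ h0)))
  have hL : ∀ i, L i (T c) = 0 := fun i => congrFun (LinearMap.mem_ker.1 hc) i
  have hbound : lam k * ‖T c‖ ^ 2 ≤ ‖S (T c)‖ ^ 2 := by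
    rw [hT]
    exact mul_norm_sq_le_norm_sq_of_eigenvectors S hv (fun j => heig j)
      (fun j => hmono (Nat.lt_succ_iff.1 j.2)) c
  have hpos : 0 < ‖T c‖ := norm_pos_iff.2 hTc
  refine ⟨‖T c‖⁻¹ • T c, norm_smul_inv_norm (𝕜 := ℝ) hTc, fun i => by simp [hL], ?_⟩
  rw [map_smul, norm_smul, norm_inv, norm_norm, inv_mul_eq_div]
  refine Real.sqrt_le_iff.2 ⟨by positivity, ?_⟩
  rwa [div_pow, le_div_iff₀ (by positivity)]

/-- The norms `‖S h‖` over any part of the unit ball are bounded by their supremum. -/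
theorem norm_apply_le_sSup {F G : Type*} [SeminormedAddCommGroup F] [NormedSpace ℝ F]
    [SeminormedAddCommGroup G] [NormedSpace ℝ G] (S : F →L[ℝ] G) (P : F → Prop)
    {h : F} (hh : ‖h‖ ≤ 1) (hP : P h) :
    ‖S h‖ ≤ sSup {r : ℝ | ∃ h : F, ‖h‖ ≤ 1 ∧ P h ∧ r = ‖S h‖} := by
  refine le_csSup ⟨‖S‖, ?_⟩ ⟨h, hh, hP, rfl⟩
  rintro _ ⟨g, hg, -, rfl⟩
  exact S.unit_le_opNorm g hg

theorem stmt4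
    (F G : Type*)
    [NormedAddCommGroup F] [InnerProductSpace ℝ F] [CompleteSpace F]
    [NormedAddCommGroup G] [InnerProductSpace ℝ G] [CompleteSpace G]
    (S : F →L[ℝ] G)
    (hScompact : IsCompactOperator (S : F → G))
    (b : ℕ → F)
    (hb : Orthonormal ℝ b)
    (hbtotal : (Submodule.span ℝ (Set.range b)).topologicalClosure = ⊤)
    (lam : ℕ → ℝ)
    (heig : ∀ j, (ContinuousLinearMap.adjoint S) (S (b j)) = lam j • b j)
    (hmono : Antitone lam)
    (hnonneg : ∀ j, 0 ≤ lam j)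
    (hlim : Tendsto lam atTop (nhds 0)) :
    (∀ (k : ℕ) (L : Fin k → (F →L[ℝ] ℝ)),
        Real.sqrt (lam k) ≤
          sSup {r : ℝ | ∃ h : F, ‖h‖ ≤ 1 ∧ (∀ i, L i h = 0) ∧ r = ‖S h‖}) ∧
    (∀ (m : ℕ) (L : Fin m → (F →L[ℝ] ℝ)) (σ : Fin m → ℝ),
        Monotone σ → (∀ i, 0 ≤ σ i) → (∀ i, ‖L i‖ ≤ 1) →
        ∀ ε : ℝ, 0 ≤ ε →
        sSup {r : ℝ | ∃ h : F, ‖h‖ ≤ 1 ∧ (∀ i, |L i h| ≤ σ i) ∧ r = ‖S h‖} ≤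
          ε * Real.sqrt (lam 0) →
        ∀ k : Fin m, ε ^ 2 * lam 0 < lam (k : ℕ) →
          σ k ≤ ε * Real.sqrt (lam 0 / lam (k : ℕ))) := by
  refine ⟨fun k L => ?_, fun m L σ hσ hσ0 hL ε hε hsup k hk => ?_⟩
  · obtain ⟨h, hh, hLh, hSh⟩ := exists_norm_eq_one_sqrt_le_norm_apply S hb heig hmono k L
    exact hSh.trans (norm_apply_le_sSup S (fun h => ∀ i, L i h = 0) hh.le hLh)
  · obtain ⟨h, hh, hLh, hSh⟩ := exists_norm_eq_one_sqrt_le_norm_apply S hb heig hmono k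
      fun i => L (Fin.castLE k.2.le i)
    set t : ℝ := min 1 (σ k)
    have ht0 : 0 ≤ t := le_min zero_le_one (hσ0 k)
    have hmem : ∀ i, |L i (t • h)| ≤ σ i := by
      intro i
      rcases lt_or_ge i k with hik | hki
      · have h0 : L i h = 0 := hLh ⟨i, hik⟩
        simpa [h0] using hσ0 i
      · have h1 : |L i h| ≤ 1 := ((L i).unit_le_opNorm h hh.le).trans (hL i)
        rw [map_smul, smul_eq_mul, abs_mul, abs_of_nonneg ht0]
        exact (mul_le_of_le_one_right ht0 h1).trans ((min_le_right _ _).trans (hσ hki))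
    have hnorm : ‖t • h‖ ≤ 1 := by
      rw [norm_smul, hh, mul_one, Real.norm_of_nonneg ht0]
      exact min_le_left _ _
    have hle : t * Real.sqrt (lam k) ≤ ε * Real.sqrt (lam 0) := by
      refine le_trans ?_
        ((norm_apply_le_sSup S (fun h => ∀ i, |L i h| ≤ σ i) hnorm hmem).trans hsup)
      rw [map_smul, norm_smul, Real.norm_of_nonneg ht0]
      gcongr
    have hlt : ε * Real.sqrt (lam 0) < Real.sqrt (lam k) := by
      refine Real.lt_sqrt_of_sq_lt ?_
      rwa [mul_pow, Real.sq_sqrt (hnonneg 0)]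
    have hpos : 0 < Real.sqrt (lam k) := lt_of_le_of_lt (by positivity) hlt
    have ht : t = σ k := by
      refine min_eq_right (le_of_not_gt fun h1 => ?_)
      rw [show t = 1 from min_eq_left h1.le, one_mul] at hle
      exact hle.not_gt hlt
    rwa [Real.sqrt_div (hnonneg 0), ← mul_div_assoc, le_div_iff₀ hpos, ← ht]
end
end

section
/- Fix d ≥ 1, n ≥ 1 and precisions σ_1, …, σ_n ≥ 0. For f ∈ F_d and e = (e_1,…,e_n) ∈ ℝ^n define the approximation Φ(f,e) = Σ_{i=1}^n (⟨f, f*_{d,i}⟩ + e_i) S_d(f*_{d,i}). Then sup over f with ‖f‖_{F_d} ≤ 1 and over e with |e_i| ≤ σ_i for all i, of ‖S_d(f) − Φ(f,e)‖_{G_d}, equals √( Σ_{i=1}^n σ_i² λ_{d,i} + λ_{d,n+1} ). -/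
open Filter
open scoped BigOperators RealInnerProductSpace

noncomputable section

/-- The cross terms `⟪S x, S y⟫` when `y` is an eigenvector of `S* S`. -/
theorem inner_map_map_of_adjoint_eigenvector
    {F G : Type*}
    [NormedAddCommGroup F] [InnerProductSpace ℝ F] [CompleteSpace F]
    [NormedAddCommGroup G] [InnerProductSpace ℝ G] [CompleteSpace G]
    (S : F →L[ℝ] G) {y : F} {c : ℝ}
    (hy : (ContinuousLinearMap.adjoint S) (S y) = c • y) (x : F) :
    ⟪S x, S y⟫ = c * ⟪x, y⟫ := by
  rw [← ContinuousLinearMap.adjoint_inner_right, hy, real_inner_smul_right]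

/-- On the orthogonal complement of the first `n` eigenvectors, `‖S g‖² ≤ λₙ ‖g‖²`. -/
theorem norm_map_sq_le_of_inner_eigenvector_eq_zero
    {F G : Type*}
    [NormedAddCommGroup F] [InnerProductSpace ℝ F] [CompleteSpace F]
    [NormedAddCommGroup G] [InnerProductSpace ℝ G] [CompleteSpace G]
    (S : F →L[ℝ] G) {b : ℕ → F} (hb : Orthonormal ℝ b)
    (hbtotal : (Submodule.span ℝ (Set.range b)).topologicalClosure = ⊤)
    {lam : ℕ → ℝ}
    (heig : ∀ j, (ContinuousLinearMap.adjoint S) (S (b j)) = lam j • b j)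
    (hmono : Antitone lam) {n : ℕ} {g : F} (hg : ∀ i < n, ⟪g, b i⟫ = 0) :
    ‖S g‖ ^ 2 ≤ lam n * ‖g‖ ^ 2 := by
  let B : HilbertBasis ℕ ℝ F := HilbertBasis.mk hb hbtotal.ge
  have hB : ∀ i, B i = b i := fun i => congrFun (HilbertBasis.coe_mk hb hbtotal.ge) i
  have h1 := B.hasSum_inner_mul_inner g (ContinuousLinearMap.adjoint S (S g))
  have h2 := (B.hasSum_inner_mul_inner g g).mul_left (lam n)
  rw [ContinuousLinearMap.adjoint_inner_right, real_inner_self_eq_norm_sq] at h1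
  rw [real_inner_self_eq_norm_sq] at h2
  refine hasSum_le (fun i => ?_) h1 h2
  rw [hB, ContinuousLinearMap.adjoint_inner_right, real_inner_comm (S g) (S (b i)),
    inner_map_map_of_adjoint_eigenvector S (heig i), real_inner_comm g (b i)]
  rcases lt_or_ge i n with hi | hi
  · simp [hg i hi]
  · nlinarith [mul_le_mul_of_nonneg_right (hmono hi) (mul_self_nonneg ⟪g, b i⟫)]

/-- Pythagoras for the image of a vector orthogonal to the first `n` eigenvectors, minus a
combination of the images of these eigenvectors. -/
theorem norm_map_sub_sum_sq
    {F G : Type*}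
    [NormedAddCommGroup F] [InnerProductSpace ℝ F] [CompleteSpace F]
    [NormedAddCommGroup G] [InnerProductSpace ℝ G] [CompleteSpace G]
    (S : F →L[ℝ] G) {b : ℕ → F} (hb : Orthonormal ℝ b) {lam : ℕ → ℝ}
    (heig : ∀ j, (ContinuousLinearMap.adjoint S) (S (b j)) = lam j • b j)
    {n : ℕ} {g : F} (hg : ∀ i < n, ⟪g, b i⟫ = 0) (e : Fin n → ℝ) :
    ‖S g - ∑ i : Fin n, e i • S (b i.1)‖ ^ 2 =
      ‖S g‖ ^ 2 + ∑ i : Fin n, e i ^ 2 * lam i.1 := by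
  have hcross : ⟪S g, ∑ i : Fin n, e i • S (b i.1)⟫ = 0 := by
    rw [inner_sum]
    refine Finset.sum_eq_zero fun i _ => ?_
    rw [real_inner_smul_right, inner_map_map_of_adjoint_eigenvector S (heig i),
      hg i i.2, mul_zero, mul_zero]
  have hsq : ‖∑ i : Fin n, e i • S (b i.1)‖ ^ 2 = ∑ i : Fin n, e i ^ 2 * lam i.1 := by
    rw [← real_inner_self_eq_norm_sq, inner_sum]
    refine Finset.sum_congr rfl fun i _ => ?_
    rw [sum_inner, Finset.sum_eq_single i]
    · rw [real_inner_smul_left, real_inner_smul_right,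
        inner_map_map_of_adjoint_eigenvector S (heig i), real_inner_self_eq_norm_sq, hb.1]
      ring
    · intro j _ hji
      rw [real_inner_smul_left, real_inner_smul_right,
        inner_map_map_of_adjoint_eigenvector S (heig i),
        hb.2 (fun h => hji (Fin.ext h))]
      ring
    · simp
  rw [norm_sub_sq_real, hcross, hsq]
  ring

theorem stmt5
    (F G : Type*)
    [NormedAddCommGroup F] [InnerProductSpace ℝ F] [CompleteSpace F]
    [NormedAddCommGroup G] [InnerProductSpace ℝ G] [CompleteSpace G]
    (S : F →L[ℝ] G)
    (hScompact : IsCompactOperator (S : F → G))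
    (hSne : S ≠ 0)
    (b : ℕ → F)
    (hb : Orthonormal ℝ b)
    (hbtotal : (Submodule.span ℝ (Set.range b)).topologicalClosure = ⊤)
    (lam : ℕ → ℝ)
    (heig : ∀ j, (ContinuousLinearMap.adjoint S) (S (b j)) = lam j • b j)
    (hmono : Antitone lam)
    (hnonneg : ∀ j, 0 ≤ lam j)
    (hlim : Tendsto lam atTop (nhds 0))
    (n : ℕ) (hn : 1 ≤ n)
    (σ : Fin n → ℝ) (hσ : ∀ i, 0 ≤ σ i) :
    sSup {r : ℝ | ∃ (f : F) (e : Fin n → ℝ), ‖f‖ ≤ 1 ∧ (∀ i, |e i| ≤ σ i) ∧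
        r = ‖S f - ∑ i : Fin n, (⟪f, b i.1⟫ + e i) • S (b i.1)‖} =
      Real.sqrt (∑ i : Fin n, σ i ^ 2 * lam i.1 + lam n) := by
  have hvec : ∀ (f : F) (e : Fin n → ℝ),
      S f - ∑ i : Fin n, (⟪f, b i.1⟫ + e i) • S (b i.1) =
        S (f - ∑ i : Fin n, ⟪f, b i.1⟫ • b i.1) - ∑ i : Fin n, e i • S (b i.1) := by
    intro f e
    simp only [add_smul, Finset.sum_add_distrib, map_sub, map_sum, map_smul]
    abel
  apply IsGreatest.csSup_eq
  constructor
  · refine ⟨b n, σ, (hb.1 n).le, fun i => (abs_of_nonneg (hσ i)).le, ?_⟩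
    have horth : ∀ i < n, ⟪b n, b i⟫ = 0 := fun i hi => hb.2 hi.ne'
    have hSb : ‖S (b n)‖ ^ 2 = lam n := by
      rw [← real_inner_self_eq_norm_sq, inner_map_map_of_adjoint_eigenvector S (heig n),
        real_inner_self_eq_norm_sq, hb.1]
      ring
    have hproj : ∑ i : Fin n, ⟪b n, b i.1⟫ • b i.1 = 0 :=
      Finset.sum_eq_zero fun i _ => by rw [horth i i.2, zero_smul]
    rw [hvec, hproj, sub_zero, ← Real.sqrt_sq (norm_nonneg (S (b n) - _)),
      norm_map_sub_sum_sq S hb heig horth, hSb, add_comm]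
  · rintro r ⟨f, e, hf, he, rfl⟩
    rw [hvec]
    set p := ∑ i : Fin n, ⟪f, b i.1⟫ • b i.1 with hp
    have hinner : ∀ i < n, ⟪p, b i⟫ = ⟪f, b i⟫ := by
      intro i hi
      rw [hp, sum_inner, Finset.sum_eq_single (⟨i, hi⟩ : Fin n)]
      · rw [real_inner_smul_left, real_inner_self_eq_norm_sq, hb.1]
        ring
      · intro j _ hji
        rw [real_inner_smul_left, hb.2 (fun h => hji (Fin.ext h)), mul_zero]
      · simp
    have horth : ∀ i < n, ⟪f - p, b i⟫ = 0 := by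
      intro i hi
      rw [inner_sub_left, hinner i hi, sub_self]
    have hfp : ⟪f - p, p⟫ = 0 := by
      nth_rewrite 2 [hp]
      rw [inner_sum]
      exact Finset.sum_eq_zero fun i _ => by
        rw [real_inner_smul_right, horth i i.2, mul_zero]
    have hnorm : ‖f - p‖ ^ 2 ≤ 1 := by
      have h := norm_add_sq_real (f - p) p
      rw [sub_add_cancel, hfp] at h
      nlinarith [sq_nonneg ‖p‖, norm_nonneg f]
    apply Real.le_sqrt_of_sq_le
    rw [norm_map_sub_sum_sq S hb heig horth, add_comm]
    refine add_le_add (Finset.sum_le_sum fun i _ => ?_) ?_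
    · exact mul_le_mul_of_nonneg_right
        (sq_le_sq.2 ((he i).trans (le_abs_self _))) (hnonneg _)
    · exact (norm_map_sq_le_of_inner_eigenvector_eq_zero S hb hbtotal heig hmono horth).trans
        (mul_le_of_le_one_right (hnonneg n) hnorm)
end
end

section
/- Fix d ≥ 1 and suppose there are C > 0, q ≥ 0 and p > 0 such that n^w(ε,d) ≤ C d^q ε^{-p} for all ε ∈ (0,1). Then for every j ≥ 2, λ_{d,j} / λ_{d,1} ≤ min( 1, (C d^q / (j−1))^{2/p} ). -/
open Filter

noncomputable section

/-- Minimal number of exact evaluations for an `ε`-approximation; the eigenvalues `μ`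
are 0-indexed, i.e. `μ j` is the `(j+1)`-st largest eigenvalue `λ_{d,j+1}`. -/
def nW (μ : ℕ → ℝ) (ε : ℝ) : ℕ :=
  sInf {n : ℕ | Real.sqrt (μ n) ≤ ε * Real.sqrt (μ 0)}

/-- The defining threshold is attained at index `nW μ ε` when `μ` tends to zero. -/
theorem sqrt_nW_le {μ : ℕ → ℝ} (hμpos : 0 < μ 0) (hμlim : Tendsto μ atTop (nhds 0))
    {ε : ℝ} (hε : 0 < ε) : Real.sqrt (μ (nW μ ε)) ≤ ε * Real.sqrt (μ 0) := by
  have hlim : Tendsto (fun n => Real.sqrt (μ n)) atTop (nhds 0) := by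
    simpa using hμlim.sqrt
  have hne : {n : ℕ | Real.sqrt (μ n) ≤ ε * Real.sqrt (μ 0)}.Nonempty :=
    (hlim.eventually_le_const (mul_pos hε (Real.sqrt_pos.2 hμpos))).exists
  exact Nat.sInf_mem hne

/-- An index whose normalized singular value exceeds `ε` lies below `nW μ ε`. -/
theorem lt_nW {μ : ℕ → ℝ} (hmono : Antitone μ) (hμpos : 0 < μ 0)
    (hμlim : Tendsto μ atTop (nhds 0)) {ε : ℝ} (hε : 0 < ε) {n : ℕ}
    (hn : ε * Real.sqrt (μ 0) < Real.sqrt (μ n)) : n < nW μ ε := by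
  by_contra! h
  exact absurd ((Real.sqrt_le_sqrt (hmono h)).trans (sqrt_nW_le hμpos hμlim hε)) hn.not_ge

theorem stmt17
    (d : ℕ) (hd : 1 ≤ d)
    (μ : ℕ → ℝ)
    (hmono : Antitone μ)
    (hnonneg : ∀ j, 0 ≤ μ j)
    (hμpos : 0 < μ 0)
    (hμlim : Tendsto μ atTop (nhds 0))
    (C q p : ℝ) (hC : 0 < C) (hq : 0 ≤ q) (hp : 0 < p)
    (hnw : ∀ ε : ℝ, 0 < ε → ε < 1 → (nW μ ε : ℝ) ≤ C * (d : ℝ) ^ q * ε ^ (-p)) :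
    ∀ j : ℕ, 2 ≤ j →
      μ (j - 1) / μ 0 ≤ min 1 ((C * (d : ℝ) ^ q / ((j : ℝ) - 1)) ^ ((2 : ℝ) / p)) := by
  intro j hj
  have hratio : μ (j - 1) / μ 0 ≤ 1 := (div_le_one hμpos).2 (hmono (Nat.zero_le _))
  refine le_min hratio ?_
  have hn : (0 : ℝ) < (j : ℝ) - 1 := by
    have : (2 : ℝ) ≤ j := by exact_mod_cast hj
    linarith
  have hcast : ((j - 1 : ℕ) : ℝ) = (j : ℝ) - 1 := by
    rw [Nat.cast_sub (by omega), Nat.cast_one]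
  have hd0 : (0 : ℝ) < d := by exact_mod_cast hd
  have hA : 0 < C * (d : ℝ) ^ q := mul_pos hC (Real.rpow_pos_of_pos hd0 q)
  set A := C * (d : ℝ) ^ q
  have hB : 0 < A / ((j : ℝ) - 1) := div_pos hA hn
  have hs : Real.sqrt (μ (j - 1) / μ 0) ≤ (A / ((j : ℝ) - 1)) ^ (1 / p) := by
    by_contra! hlt
    obtain ⟨ε, hε₁, hε₂⟩ := exists_between hlt
    have hε : 0 < ε := (Real.rpow_pos_of_pos hB _).trans hε₁
    have hε_one : ε < 1 := hε₂.trans_le (Real.sqrt_le_one.2 hratio)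
    rw [Real.sqrt_div (hnonneg _), lt_div_iff₀ (Real.sqrt_pos.2 hμpos)] at hε₂
    have hle : (j : ℝ) - 1 ≤ A * ε ^ (-p) := by
      rw [← hcast]
      exact (Nat.cast_le.2 (lt_nW hmono hμpos hμlim hε hε₂).le).trans (hnw ε hε hε_one)
    rw [Real.rpow_neg hε.le, ← div_eq_mul_inv, le_div_iff₀ (Real.rpow_pos_of_pos hε p)] at hle
    have hpow : A / ((j : ℝ) - 1) < ε ^ p := by
      rwa [one_div, Real.rpow_inv_lt_iff_of_pos hB.le hε.le hp] at hε₁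
    rw [div_lt_iff₀ hn] at hpow
    linarith
  calc μ (j - 1) / μ 0 = Real.sqrt (μ (j - 1) / μ 0) ^ 2 :=
        (Real.sq_sqrt (div_nonneg (hnonneg _) hμpos.le)).symm
    _ ≤ ((A / ((j : ℝ) - 1)) ^ (1 / p)) ^ 2 := by gcongr
    _ = (A / ((j : ℝ) - 1)) ^ ((2 : ℝ) / p) := by
        rw [← Real.rpow_mul_natCast hB.le]
        congr 1
        push_cast
        ring
end
end

section
/- Let n ≥ 1, s > 0, B > 0 and let λ_1, …, λ_n be positive reals. Then inf{ Σ_{i=1}^n σ_i^{-2s} : σ_1, …, σ_n > 0 with Σ_{i=1}^n σ_i² λ_i ≤ B } = ( Σ_{i=1}^n λ_i^{s/(s+1)} )^{s+1} · B^{-s}, and the infimum is attained at σ̂_k defined by σ̂_k^{-2} = λ_k^{1/(s+1)} ( Σ_{i=1}^n λ_i^{s/(s+1)} ) / B for 1 ≤ k ≤ n. -/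
open scoped BigOperators

/-- Lower bound on the cost `∑ σᵢ^(-2s)` under the budget `∑ σᵢ² λᵢ ≤ B`, by Hölder's inequality. -/
theorem rpow_sum_mul_rpow_neg_le_cost {ι : Type*} (t : Finset ι) {s B : ℝ} (hs : 0 < s)
    (hB : 0 < B) {lam σ : ι → ℝ} (hlam : ∀ i, 0 < lam i) (hσ : ∀ i, 0 < σ i)
    (hbudget : ∑ i ∈ t, σ i ^ 2 * lam i ≤ B) :
    (∑ i ∈ t, lam i ^ (s / (s + 1))) ^ (s + 1) * B ^ (-s) ≤ ∑ i ∈ t, σ i ^ (-(2 * s)) := by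
  have hs1 : 0 < s + 1 := by linarith
  have hpq : (s + 1).HolderConjugate ((s + 1) / s) := by
    rw [Real.holderConjugate_iff]
    refine ⟨by linarith, ?_⟩
    field_simp
    ring
  have holder := Real.inner_le_Lp_mul_Lq_of_nonneg t hpq
    (f := fun i => σ i ^ (-(2 * s) / (s + 1))) (g := fun i => (σ i ^ 2 * lam i) ^ (s / (s + 1)))
    (fun i _ => (Real.rpow_pos_of_pos (hσ i) _).le)
    (fun i _ => Real.rpow_nonneg (mul_nonneg (sq_nonneg _) (hlam i).le) _)
  have hprod : ∀ i, σ i ^ (-(2 * s) / (s + 1)) * (σ i ^ 2 * lam i) ^ (s / (s + 1)) =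
      lam i ^ (s / (s + 1)) := by
    intro i
    rw [Real.mul_rpow (sq_nonneg _) (hlam i).le, ← mul_assoc, ← Real.rpow_natCast,
      ← Real.rpow_mul (hσ i).le, ← Real.rpow_add (hσ i)]
    have : -(2 * s) / (s + 1) + ((2 : ℕ) : ℝ) * (s / (s + 1)) = 0 := by push_cast; ring
    rw [this, Real.rpow_zero, one_mul]
  have hleft : ∀ i, (σ i ^ (-(2 * s) / (s + 1))) ^ (s + 1) = σ i ^ (-(2 * s)) := by
    intro i
    rw [← Real.rpow_mul (hσ i).le, div_mul_cancel₀ _ hs1.ne']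
  have hright : ∀ i, ((σ i ^ 2 * lam i) ^ (s / (s + 1))) ^ ((s + 1) / s) = σ i ^ 2 * lam i := by
    intro i
    rw [← Real.rpow_mul (mul_nonneg (sq_nonneg _) (hlam i).le),
      div_mul_div_cancel₀ hs1.ne', div_self hs.ne', Real.rpow_one]
  simp only [hprod, hleft, hright] at holder
  have hC : 0 ≤ ∑ i ∈ t, σ i ^ (-(2 * s)) :=
    Finset.sum_nonneg fun i _ => (Real.rpow_pos_of_pos (hσ i) _).le
  have hT : 0 ≤ ∑ i ∈ t, σ i ^ 2 * lam i :=
    Finset.sum_nonneg fun i _ => mul_nonneg (sq_nonneg _) (hlam i).le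
  have hS : 0 ≤ ∑ i ∈ t, lam i ^ (s / (s + 1)) :=
    Finset.sum_nonneg fun i _ => (Real.rpow_pos_of_pos (hlam i) _).le
  have hpow := Real.rpow_le_rpow hS holder hs1.le
  rw [Real.mul_rpow (Real.rpow_nonneg hC _) (Real.rpow_nonneg hT _), ← Real.rpow_mul hC,
    ← Real.rpow_mul hT, one_div_mul_cancel hs1.ne', Real.rpow_one,
    show 1 / ((s + 1) / s) * (s + 1) = s by field_simp] at hpow
  rw [Real.rpow_neg hB.le, ← div_eq_mul_inv, div_le_iff₀ (Real.rpow_pos_of_pos hB s)]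
  exact hpow.trans (mul_le_mul_of_nonneg_left (Real.rpow_le_rpow hT hbudget hs.le) hC)

/-- The noise levels `σᵢ^(-2) = λᵢ^(1/(s+1)) S / B`, with `S = ∑ λᵢ^(s/(s+1))`, exhaust the budget
`B` and have cost `S^(s+1) B^(-s)`. -/
theorem budget_and_cost_of_rpow_neg_two_eq {ι : Type*} {t : Finset ι} (ht : t.Nonempty) {s B : ℝ}
    (hs : 0 < s) (hB : 0 < B) {lam σ : ι → ℝ} (hlam : ∀ i, 0 < lam i) (hσ : ∀ i, 0 < σ i)
    (h : ∀ k, σ k ^ (-2 : ℝ) =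
      lam k ^ ((1 : ℝ) / (s + 1)) * (∑ i ∈ t, lam i ^ (s / (s + 1))) / B) :
    ∑ i ∈ t, σ i ^ 2 * lam i = B ∧
      ∑ i ∈ t, σ i ^ (-(2 * s)) =
        (∑ i ∈ t, lam i ^ (s / (s + 1))) ^ (s + 1) * B ^ (-s) := by
  have hs1 : 0 < s + 1 := by linarith
  have hS : 0 < ∑ i ∈ t, lam i ^ (s / (s + 1)) :=
    Finset.sum_pos (fun i _ => Real.rpow_pos_of_pos (hlam i) _) ht
  set S := ∑ i ∈ t, lam i ^ (s / (s + 1)) with hSdef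
  have hbudget : ∀ i, σ i ^ 2 * lam i = lam i ^ (s / (s + 1)) * (B / S) := by
    intro i
    have hi := h i
    rw [Real.rpow_neg (hσ i).le, Real.rpow_two] at hi
    have hsplit : lam i = lam i ^ (s / (s + 1)) * lam i ^ ((1 : ℝ) / (s + 1)) := by
      rw [← Real.rpow_add (hlam i), ← add_div, div_self hs1.ne', Real.rpow_one]
    have hsq : σ i ^ 2 = B / (lam i ^ ((1 : ℝ) / (s + 1)) * S) := by
      rw [← inv_inv (σ i ^ 2), hi, inv_div]
    have hpos := Real.rpow_pos_of_pos (hlam i) ((1 : ℝ) / (s + 1))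
    calc σ i ^ 2 * lam i
        = B / (lam i ^ ((1 : ℝ) / (s + 1)) * S) *
            (lam i ^ (s / (s + 1)) * lam i ^ ((1 : ℝ) / (s + 1))) := by rw [hsq, ← hsplit]
      _ = lam i ^ (s / (s + 1)) * (B / S) := by
        generalize lam i ^ ((1 : ℝ) / (s + 1)) = u at hpos ⊢
        field_simp
  have hcost : ∀ i, σ i ^ (-(2 * s)) = lam i ^ (s / (s + 1)) * (S / B) ^ s := by
    intro i
    have hpos := Real.rpow_pos_of_pos (hlam i) ((1 : ℝ) / (s + 1))
    rw [← neg_mul, Real.rpow_mul (hσ i).le, h i, mul_div_assoc,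
      Real.mul_rpow hpos.le (div_pos hS hB).le, ← Real.rpow_mul (hlam i).le, one_div_mul_eq_div]
  simp only [hbudget, hcost, ← Finset.sum_mul, ← hSdef]
  refine ⟨mul_div_cancel₀ B hS.ne', ?_⟩
  rw [Real.div_rpow hS.le hB.le, Real.rpow_neg hB.le, Real.rpow_add hS, Real.rpow_one]
  ring

theorem stmt18
    (n : ℕ) (hn : 1 ≤ n)
    (s B : ℝ) (hs : 0 < s) (hB : 0 < B)
    (lam : Fin n → ℝ) (hlam : ∀ i, 0 < lam i) :
    sInf {c : ℝ | ∃ σ : Fin n → ℝ, (∀ i, 0 < σ i) ∧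
        (∑ i, σ i ^ 2 * lam i ≤ B) ∧ c = ∑ i, σ i ^ (-(2 * s))} =
      (∑ i, lam i ^ (s / (s + 1))) ^ (s + 1) * B ^ (-s) ∧
    ∀ σhat : Fin n → ℝ,
      (∀ k, σhat k ^ (-2 : ℝ) =
        lam k ^ ((1 : ℝ) / (s + 1)) * (∑ i, lam i ^ (s / (s + 1))) / B) →
      (∀ k, 0 < σhat k) →
      (∑ i, σhat i ^ 2 * lam i ≤ B) ∧
      ∑ i, σhat i ^ (-(2 * s)) =
        (∑ i, lam i ^ (s / (s + 1))) ^ (s + 1) * B ^ (-s) := by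
  have hne : (Finset.univ : Finset (Fin n)).Nonempty := ⟨⟨0, hn⟩, Finset.mem_univ _⟩
  have hopt : ∀ σ : Fin n → ℝ, (∀ k, σ k ^ (-2 : ℝ) =
      lam k ^ ((1 : ℝ) / (s + 1)) * (∑ i, lam i ^ (s / (s + 1))) / B) → (∀ k, 0 < σ k) →
      (∑ i, σ i ^ 2 * lam i ≤ B) ∧ ∑ i, σ i ^ (-(2 * s)) =
        (∑ i, lam i ^ (s / (s + 1))) ^ (s + 1) * B ^ (-s) := fun σ h hσ =>
    (budget_and_cost_of_rpow_neg_two_eq hne hs hB hlam hσ h).imp_left le_of_eq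
  refine ⟨IsLeast.csInf_eq ⟨?_, ?_⟩, hopt⟩
  · have hpos : ∀ k, 0 < lam k ^ ((1 : ℝ) / (s + 1)) * (∑ i, lam i ^ (s / (s + 1))) / B :=
      fun k => div_pos (mul_pos (Real.rpow_pos_of_pos (hlam k) _)
        (Finset.sum_pos (fun i _ => Real.rpow_pos_of_pos (hlam i) _) hne)) hB
    have hσ := fun k => Real.rpow_pos_of_pos (hpos k) (-2 : ℝ)⁻¹
    obtain ⟨hbudget, hcost⟩ := hopt _
      (fun k => Real.rpow_inv_rpow (hpos k).le (by norm_num : (-2 : ℝ) ≠ 0)) hσ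
    exact ⟨_, hσ, hbudget, hcost.symm⟩
  · rintro c ⟨σ, hσ, hbudget, rfl⟩
    exact rpow_sum_mul_rpow_neg_le_cost Finset.univ hs hB hlam hσ hbudget
end

section
/- Let n ≥ 1 be an integer, σ > 0, and for 1 ≤ i ≤ n set θ_i = π(i−1)/(2n). Then sup{ √(x₁² + x₂²) : (x₁,x₂) ∈ ℝ², |x₁ cos θ_i − x₂ sin θ_i| ≤ σ and |x₁ sin θ_i + x₂ cos θ_i| ≤ σ for every 1 ≤ i ≤ n } = σ / cos(π/(4n)). -/
open Real

noncomputable section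

/-- Up to sign, a translate of `ψ` by a multiple of `π / 2` has cosine or sine `cos ψ`. -/
lemma abs_cos_eq_abs_cos_or_abs_sin_sub_int_mul_pi_div_two (ψ : ℝ) (q : ℤ) :
    |Real.cos ψ| = |Real.cos (ψ - q * (π / 2))| ∨ |Real.cos ψ| = |Real.sin (ψ - q * (π / 2))| := by
  rcases Int.even_or_odd' q with ⟨m, rfl | rfl⟩
  · left
    have h : ψ - ((2 * m : ℤ) : ℝ) * (π / 2) = ψ - m * π := by push_cast; ring
    rw [h, Real.cos_sub_int_mul_pi, abs_mul, abs_neg_one_zpow, one_mul]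
  · right
    have h : ψ - ((2 * m + 1 : ℤ) : ℝ) * (π / 2) = (ψ - m * π) - π / 2 := by push_cast; ring
    rw [h, Real.sin_sub_pi_div_two, abs_neg, Real.cos_sub_int_mul_pi, abs_mul, abs_neg_one_zpow,
      one_mul]

/-- One of the rotations of a direction `φ` by multiples of `π / (2 n)` lies within angle
`π / (4 n)` of a coordinate axis. -/
lemma exists_cos_le_abs_cos_or_abs_sin_add (n : ℕ) (hn : 1 ≤ n) (φ : ℝ) :
    ∃ i : Fin n, Real.cos (π / (4 * n)) ≤ |Real.cos (φ + π * (i : ℕ) / (2 * n))| ∨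
      Real.cos (π / (4 * n)) ≤ |Real.sin (φ + π * (i : ℕ) / (2 * n))| := by
  have hn0 : (0 : ℝ) < n := by exact_mod_cast hn
  have hnz : (n : ℤ) ≠ 0 := by omega
  have hπ := Real.pi_pos
  obtain ⟨δ, hδ⟩ : ∃ δ, δ = π / (2 * n) := ⟨_, rfl⟩
  have hδ0 : 0 < δ := by rw [hδ]; positivity
  obtain ⟨k, hk⟩ : ∃ k, k = round (φ / δ) := ⟨_, rfl⟩
  have hψ : |φ - k * δ| ≤ π / (4 * n) := by
    have h1 := abs_sub_round (φ / δ)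
    rw [← hk] at h1
    have h2 : φ - k * δ = (φ / δ - k) * δ := by field_simp
    rw [h2, abs_mul, abs_of_pos hδ0]
    calc |φ / δ - k| * δ ≤ 1 / 2 * δ := by gcongr
      _ = π / (4 * n) := by rw [hδ]; field_simp; ring
  have hcos : Real.cos (π / (4 * n)) ≤ |Real.cos (φ - k * δ)| := by
    rw [← Real.cos_abs (φ - k * δ)]
    refine le_trans (Real.cos_le_cos_of_nonneg_of_le_pi (abs_nonneg _) ?_ hψ) (le_abs_self _)
    rw [div_le_iff₀ (by positivity)]
    have : (1 : ℝ) ≤ n := by exact_mod_cast hn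
    nlinarith
  have hmod : 0 ≤ (-k) % (n : ℤ) := Int.emod_nonneg _ hnz
  have hlt : (-k) % (n : ℤ) < n := Int.emod_lt_of_pos _ (by omega)
  have hcast : (((-k) % (n : ℤ)).toNat : ℝ) = -k - n * (((-k) / (n : ℤ) : ℤ) : ℝ) := by
    have h1 : (((-k) % (n : ℤ)).toNat : ℤ) = -k - n * ((-k) / (n : ℤ)) := by
      rw [Int.toNat_of_nonneg hmod, Int.emod_def]
    exact_mod_cast h1
  refine ⟨⟨((-k) % (n : ℤ)).toNat, by omega⟩, ?_⟩
  have hang : φ + π * (((-k) % (n : ℤ)).toNat : ℝ) / (2 * n) =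
      (φ - k * δ) - (((-k) / (n : ℤ) : ℤ) : ℝ) * (π / 2) := by
    rw [hcast, hδ]; field_simp; ring
  simp only [hang]
  rcases abs_cos_eq_abs_cos_or_abs_sin_sub_int_mul_pi_div_two (φ - k * δ) ((-k) / (n : ℤ))
    with h | h
  · exact Or.inl (h ▸ hcos)
  · exact Or.inr (h ▸ hcos)

theorem stmt19
    (n : ℕ) (hn : 1 ≤ n) (σ : ℝ) (hσ : 0 < σ) :
    sSup {r : ℝ | ∃ x₁ x₂ : ℝ,
        (∀ i : Fin n,
          |x₁ * Real.cos (π * (i : ℕ) / (2 * n)) - x₂ * Real.sin (π * (i : ℕ) / (2 * n))| ≤ σ ∧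
          |x₁ * Real.sin (π * (i : ℕ) / (2 * n)) + x₂ * Real.cos (π * (i : ℕ) / (2 * n))| ≤ σ) ∧
        r = Real.sqrt (x₁ ^ 2 + x₂ ^ 2)} =
      σ / Real.cos (π / (4 * n)) := by
  have hn1 : (1 : ℝ) ≤ n := by exact_mod_cast hn
  have hn0 : (0 : ℝ) < n := by linarith
  have hπ := Real.pi_pos
  have hα0 : 0 < π / (4 * n) := by positivity
  have hα1 : π / (4 * n) < π / 2 := by
    apply div_lt_div_of_pos_left hπ (by norm_num)
    linarith
  have hc : 0 < Real.cos (π / (4 * n)) := Real.cos_pos_of_mem_Ioo ⟨by linarith, hα1⟩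
  have e1 : ∀ R φ θ : ℝ, R * Real.cos φ * Real.cos θ - R * Real.sin φ * Real.sin θ =
      R * Real.cos (φ + θ) := fun R φ θ => by rw [Real.cos_add]; ring
  have e2 : ∀ R φ θ : ℝ, R * Real.cos φ * Real.sin θ + R * Real.sin φ * Real.cos θ =
      R * Real.sin (φ + θ) := fun R φ θ => by rw [Real.sin_add]; ring
  have e3 : ∀ R φ : ℝ, 0 ≤ R →
      Real.sqrt ((R * Real.cos φ) ^ 2 + (R * Real.sin φ) ^ 2) = R := fun R φ hR => by
    rw [show (R * Real.cos φ) ^ 2 + (R * Real.sin φ) ^ 2 =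
      R ^ 2 * (Real.sin φ ^ 2 + Real.cos φ ^ 2) by ring, Real.sin_sq_add_cos_sq, mul_one,
      Real.sqrt_sq hR]
  refine IsGreatest.csSup_eq ⟨?_, ?_⟩
  · refine ⟨σ / Real.cos (π / (4 * n)) * Real.cos (π / (4 * n)),
      σ / Real.cos (π / (4 * n)) * Real.sin (π / (4 * n)), fun i => ?_,
      (e3 _ _ (by positivity)).symm⟩
    have hi : ((i : ℕ) : ℝ) + 1 ≤ n := by exact_mod_cast i.2
    have hθ0 : 0 ≤ π * (i : ℕ) / (2 * n) := by positivity
    have hθ1 : π / (4 * n) + π * (i : ℕ) / (2 * n) ≤ π / 2 - π / (4 * n) := by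
      have h : π / 2 - π / (4 * n) - (π / (4 * n) + π * (i : ℕ) / (2 * n)) =
          π * (n - (i + 1)) / (2 * n) := by field_simp; ring
      have : 0 ≤ π * ((n : ℝ) - (i + 1)) / (2 * n) :=
        div_nonneg (mul_nonneg hπ.le (by linarith)) (by positivity)
      linarith
    have key : ∀ c : ℝ, 0 ≤ c → c ≤ Real.cos (π / (4 * n)) →
        |σ / Real.cos (π / (4 * n)) * c| ≤ σ := fun c h0 h1 => by
      rw [abs_of_nonneg (by positivity), div_mul_eq_mul_div, div_le_iff₀ hc]
      gcongr
    rw [e1, e2]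
    constructor
    · exact key _ (Real.cos_nonneg_of_mem_Icc ⟨by linarith, by linarith⟩)
        (Real.cos_le_cos_of_nonneg_of_le_pi hα0.le (by linarith) (by linarith))
    · rw [← Real.cos_pi_div_two_sub]
      exact key _ (Real.cos_nonneg_of_mem_Icc ⟨by linarith, by linarith⟩)
        (Real.cos_le_cos_of_nonneg_of_le_pi hα0.le (by linarith) (by linarith))
  · rintro r ⟨x₁, x₂, h, rfl⟩
    obtain ⟨R, φ, hR, rfl, rfl⟩ :
        ∃ R φ : ℝ, 0 ≤ R ∧ x₁ = R * Real.cos φ ∧ x₂ = R * Real.sin φ :=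
      ⟨‖(⟨x₁, x₂⟩ : ℂ)‖, Complex.arg ⟨x₁, x₂⟩, norm_nonneg _,
        (Complex.norm_mul_cos_arg ⟨x₁, x₂⟩).symm, (Complex.norm_mul_sin_arg ⟨x₁, x₂⟩).symm⟩
    rw [e3 R φ hR, le_div_iff₀ hc]
    obtain ⟨i, hi⟩ := exists_cos_le_abs_cos_or_abs_sin_add n hn φ
    have hb := h i
    rw [e1, e2, abs_mul, abs_mul, abs_of_nonneg hR] at hb
    rcases hi with hi | hi
    · exact (mul_le_mul_of_nonneg_left hi hR).trans hb.1
    · exact (mul_le_mul_of_nonneg_left hi hR).trans hb.2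
end
end
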